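/- arXiv:1302.3079 — 3 statements merged into one kernel-verified Lean document; each statement's English description precedes it below -/
import Mathlib

section
/- There is a constant C > 0 (depending on D) such that for every nonzero ideal 𝔞 ⊆ O_D with N(𝔞) > C one has κ(Γ(𝔞)) = d_F · [Γ(D) : Γ(𝔞)] / (#(O_D^×) · N(𝔞)), where d_F is the class number of F and O_D^× is the unit group of O_D. -/
open scoped MatrixGroups

set_option maxHeartbeats 1000000
set_option synthInstance.maxHeartbeats 400000

noncomputable section

namespace Bianchi

open NumberField MvPolynomial Finsupp

/-- `√(-D)` as a complex number. -/
def sqrtNeg (D : ℕ) : ℂ := Complex.I * (Real.sqrt D : ℂ)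

lemma sqrtNeg_sq (D : ℕ) : sqrtNeg D ^ 2 = -(D : ℂ) := by
  have h : ((Real.sqrt D : ℝ) : ℂ) ^ 2 = (D : ℂ) := by
    norm_cast
    exact_mod_cast Real.sq_sqrt (by positivity : (0:ℝ) ≤ (D:ℝ))
  simp [sqrtNeg, mul_pow, Complex.I_sq, h]

/-- The imaginary quadratic field `F = ℚ(√-D)`, realized inside `ℂ`. -/
def F (D : ℕ) : IntermediateField ℚ ℂ := IntermediateField.adjoin ℚ {sqrtNeg D}

lemma isIntegral_sqrtNeg (D : ℕ) : IsIntegral ℚ (sqrtNeg D) := by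
  refine ⟨Polynomial.X ^ 2 + Polynomial.C (D : ℚ), Polynomial.monic_X_pow_add_C _ (by norm_num), ?_⟩
  simp [Polynomial.eval₂, sqrtNeg_sq]

instance (D : ℕ) : FiniteDimensional ℚ (F D) :=
  IntermediateField.adjoin.finiteDimensional (isIntegral_sqrtNeg D)

instance (D : ℕ) : NumberField (F D) := ⟨⟩

/-- The principal congruence subgroup `Γ(𝔞)` of the Bianchi group `Γ(D) = SL(2, O_D)`:
the matrices that are congruent to the identity modulo `𝔞` entrywise, i.e. the kernel of
entrywise reduction mod `𝔞`. -/
def Gamma (D : ℕ) (𝔞 : Ideal (𝓞 (F D))) : Subgroup SL(2, 𝓞 (F D)) :=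
  (Matrix.SpecialLinearGroup.map (Ideal.Quotient.mk 𝔞)).ker

/-- A congruence subgroup of the Bianchi group: a subgroup containing some `Γ(𝔞)`, `𝔞 ≠ 0`. -/
def IsCongruence (D : ℕ) (Γ : Subgroup SL(2, 𝓞 (F D))) : Prop :=
  ∃ 𝔞 : Ideal (𝓞 (F D)), 𝔞 ≠ ⊥ ∧ Gamma D 𝔞 ≤ Γ

/-- The projective line `ℙ¹(F)`. -/
abbrev P1 (D : ℕ) := Projectivization (F D) (Fin 2 → F D)

section P1action

variable {K : Type*} [Field K]

lemma toLin'_injective (g : SL(2, K)) :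
    Function.Injective (Matrix.toLin' (g : Matrix (Fin 2) (Fin 2) K)) := by
  intro x y h
  have h2 : ∀ v : Fin 2 → K,
      Matrix.toLin' ((g⁻¹ : SL(2,K)) : Matrix (Fin 2) (Fin 2) K)
        (Matrix.toLin' (g : Matrix (Fin 2) (Fin 2) K) v) = v := by
    intro v
    rw [← Matrix.toLin'_mul_apply, ← Matrix.SpecialLinearGroup.coe_mul, inv_mul_cancel,
      Matrix.SpecialLinearGroup.coe_one, Matrix.toLin'_one, LinearMap.id_apply]
  rw [← h2 x, ← h2 y, h]

/-- The action of `SL₂` on the projective line by linear fractional transformations. -/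
instance instSMulSL : SMul (SL(2,K)) (Projectivization K (Fin 2 → K)) :=
  ⟨fun g x => Projectivization.map
      ((Matrix.toLin' (g : Matrix (Fin 2) (Fin 2) K)) : (Fin 2 → K) →ₗ[K] (Fin 2 → K))
      (toLin'_injective g) x⟩

lemma smul_mk (g : SL(2,K)) (v : Fin 2 → K) (hv : v ≠ 0) :
    g • Projectivization.mk K v hv =
      Projectivization.mk K (Matrix.toLin' (g : Matrix (Fin 2) (Fin 2) K) v)
        (by simpa using (toLin'_injective g).ne_iff' (map_zero _) |>.2 hv) := rfl

instance instMulActionSL : MulAction (SL(2,K)) (Projectivization K (Fin 2 → K)) where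
  one_smul x := by
    induction x using Projectivization.ind with
    | h v hv =>
      rw [smul_mk]
      simp only [Matrix.SpecialLinearGroup.coe_one, Matrix.toLin'_one, LinearMap.id_apply]
  mul_smul g h x := by
    induction x using Projectivization.ind with
    | h v hv =>
      rw [smul_mk, smul_mk, smul_mk]
      simp only [Matrix.SpecialLinearGroup.coe_mul, Matrix.toLin'_mul, LinearMap.comp_apply]

lemma e10_ne (K : Type*) [Field K] : (![1, 0] : Fin 2 → K) ≠ 0 := by
  intro h
  have := congrFun h 0
  simp at this

/-- The point `∞ = [1 : 0]` of the projective line. -/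
def infty (K : Type*) [Field K] : Projectivization K (Fin 2 → K) :=
  Projectivization.mk K ![1, 0] (e10_ne K)

end P1action

/-- The inclusion `SL(2, O_D) → SL(2, F)`. -/
def toSLF (D : ℕ) : SL(2, 𝓞 (F D)) →* SL(2, F D) :=
  Matrix.SpecialLinearGroup.map (algebraMap (𝓞 (F D)) (F D))

/-- The action of the Bianchi group on `ℙ¹(F)`. -/
instance (D : ℕ) : MulAction (SL(2, 𝓞 (F D))) (P1 D) :=
  MulAction.compHom _ (toSLF D)

/-- The number of cusps of a subgroup of the Bianchi group:
the number of its orbits on `ℙ¹(F)`. -/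
def cusps (D : ℕ) (Γ : Subgroup SL(2, 𝓞 (F D))) : ℕ :=
  Nat.card (MulAction.orbitRel.Quotient Γ (P1 D))

section GroupAction

variable {G X : Type*} [Group G] [MulAction G X]

/-- The map from the orbits of a subgroup to the orbits of the whole group. -/
def orbitsMap (N : Subgroup G) :
    MulAction.orbitRel.Quotient N X → MulAction.orbitRel.Quotient G X :=
  Quotient.map' id fun _ _ h => by
    obtain ⟨n, hn⟩ := h
    exact ⟨(n : G), hn⟩

lemma card_fiber_orbitsMap (N : Subgroup G) [N.Normal] (x : X) :
    Nat.card {y : MulAction.orbitRel.Quotient N X // orbitsMap N y = Quotient.mk'' x} =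
      (MulAction.stabilizer G x ⊔ N).index := by
  symm
  let f : G → {y : MulAction.orbitRel.Quotient N X // orbitsMap N y = Quotient.mk'' x} :=
    fun g => ⟨Quotient.mk'' (g • x), Quotient.sound' ⟨g, rfl⟩⟩
  have hf : ∀ g h : G, f g = f h ↔ g⁻¹ * h ∈ MulAction.stabilizer G x ⊔ N := by
    intro g h
    rw [Subtype.ext_iff, Quotient.eq'', MulAction.orbitRel_apply, Subgroup.mem_sup_of_normal_right]
    constructor
    · rintro ⟨n, hn⟩
      have hn : (n : G) • h • x = g • x := hn
      refine ⟨g⁻¹ * n * h, ?_, h⁻¹ * (n : G)⁻¹ * h, ?_, by group⟩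
      · rw [MulAction.mem_stabilizer_iff, mul_smul, mul_smul, hn, inv_smul_smul]
      · have := Subgroup.Normal.conj_mem ‹N.Normal› _ (N.inv_mem n.2) h⁻¹
        simpa using this
    · rintro ⟨s, hs, n, hn, hsn⟩
      have hh : h = g * s * n := by rw [mul_assoc, hsn]; group
      refine ⟨⟨(g * s) * n⁻¹ * (g * s)⁻¹,
        Subgroup.Normal.conj_mem ‹N.Normal› _ (N.inv_mem hn) _⟩, ?_⟩
      change ((g * s) * n⁻¹ * (g * s)⁻¹) • h • x = g • x
      rw [hh, ← mul_smul]
      have : g * s * n⁻¹ * (g * s)⁻¹ * (g * s * n) = g * s := by group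
      rw [this, mul_smul, MulAction.mem_stabilizer_iff.1 hs]
  refine Nat.card_eq_of_bijective (Quotient.lift f fun g h hgh => (hf g h).2
    (QuotientGroup.leftRel_apply.1 hgh)) ⟨?_, ?_⟩
  · rintro ⟨g⟩ ⟨h⟩ hgh
    exact Quotient.sound' (QuotientGroup.leftRel_apply.2 ((hf g h).1 hgh))
  · rintro ⟨⟨y⟩, hy⟩
    obtain ⟨g, hg⟩ := Quotient.eq''.1 hy
    exact ⟨Quotient.mk'' g, Subtype.ext (congrArg Quotient.mk'' hg)⟩

/-- If a finite-index normal subgroup `N` meets every point stabilizer in a subgroup of the same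
index `m`, then the numbers of orbits of `N` and of `G` are related by the index of `N`. -/
lemma card_orbits_mul_of_relIndex_stabilizer (N : Subgroup G) [N.Normal] [N.FiniteIndex] (m : ℕ)
    [Finite (MulAction.orbitRel.Quotient G X)]
    (hm : ∀ x : X, N.relIndex (MulAction.stabilizer G x) = m) :
    Nat.card (MulAction.orbitRel.Quotient N X) * m =
      Nat.card (MulAction.orbitRel.Quotient G X) * N.index := by
  have hfib : ∀ ω : MulAction.orbitRel.Quotient G X,
      Nat.card {y : MulAction.orbitRel.Quotient N X // orbitsMap N y = ω} * m = N.index := by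
    rintro ⟨x⟩
    rw [← hm x, ← Subgroup.relIndex_sup_right, mul_comm]
    exact (congrArg _ (card_fiber_orbitsMap N x)).trans
      (Subgroup.relIndex_mul_index le_sup_right)
  have hfin : ∀ ω : MulAction.orbitRel.Quotient G X,
      Finite {y : MulAction.orbitRel.Quotient N X // orbitsMap N y = ω} := by
    intro ω
    refine Nat.finite_of_card_ne_zero fun h0 => ?_
    have := hfib ω
    rw [h0, zero_mul] at this
    exact Subgroup.FiniteIndex.index_ne_zero this.symm
  have := Fintype.ofFinite (MulAction.orbitRel.Quotient G X)
  rw [Nat.card_congr (Equiv.sigmaFiberEquiv (orbitsMap (X := X) N)).symm, Nat.card_sigma,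
    Finset.sum_mul, Finset.sum_congr rfl fun ω _ => hfib ω]
  simp

end GroupAction

section SpecialLinear

open scoped nonZeroDivisors

variable {R K : Type*} [CommRing R] [Field K] [Algebra R K]

/-- In the basis `(a, b), (-β, α)` of `K²`, the matrix `g` is upper triangular with diagonal
`u, u⁻¹` and upper right entry `t`. -/
structure IsTriangularIn (a b α β : K) (g : SL(2, R)) (u : Rˣ) (t : K) : Prop where
  apply_zero_zero : algebraMap R K (g 0 0) =
    algebraMap R K u * (a * α) + algebraMap R K ↑u⁻¹ * (b * β) - a * b * t
  apply_zero_one : algebraMap R K (g 0 1) =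
    (algebraMap R K u - algebraMap R K ↑u⁻¹) * (a * β) + a * a * t
  apply_one_zero : algebraMap R K (g 1 0) =
    (algebraMap R K u - algebraMap R K ↑u⁻¹) * (b * α) - b * b * t
  apply_one_one : algebraMap R K (g 1 1) =
    algebraMap R K u * (b * β) + algebraMap R K ↑u⁻¹ * (a * α) + a * b * t

lemma map_mul_map_inv (u : Rˣ) : algebraMap R K u * algebraMap R K ↑u⁻¹ = 1 := by
  rw [← map_mul, Units.mul_inv, map_one]

lemma map_det_eq_one (g : SL(2, R)) :
    algebraMap R K (g 0 0) * algebraMap R K (g 1 1)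
      - algebraMap R K (g 0 1) * algebraMap R K (g 1 0) = 1 := by
  rw [← map_mul, ← map_mul, ← map_sub, ← Matrix.det_fin_two, g.det_coe, map_one]

lemma IsTriangularIn.mul_left_eq {a b α β : K} (hab : a * α + b * β = 1) {g : SL(2, R)} {u : Rˣ}
    {t : K} (hg : IsTriangularIn a b α β g u t) :
    algebraMap R K (g 0 0) * a + algebraMap R K (g 0 1) * b = algebraMap R K u * a ∧
      algebraMap R K (g 1 0) * a + algebraMap R K (g 1 1) * b = algebraMap R K u * b := by
  obtain ⟨e1, e2, e3, e4⟩ := hg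
  rw [e1, e2, e3, e4]
  constructor
  · linear_combination algebraMap R K u * a * hab
  · linear_combination algebraMap R K u * b * hab

lemma map_mem_coeIdeal [IsFractionRing R K] {𝔞 : Ideal R} {x : R} :
    algebraMap R K x ∈ (𝔞 : FractionalIdeal R⁰ K) ↔ x ∈ 𝔞 := by
  rw [FractionalIdeal.mem_coeIdeal]
  exact ⟨fun ⟨y, hy, hyx⟩ => IsFractionRing.injective R K hyx ▸ hy, fun hx => ⟨x, hx, rfl⟩⟩

lemma inv_mul_mem_ker_map_iff {R : Type*} [CommRing R] (𝔞 : Ideal R) (g h : SL(2, R)) :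
    g⁻¹ * h ∈ (Matrix.SpecialLinearGroup.map (n := Fin 2) (Ideal.Quotient.mk 𝔞)).ker ↔
      ∀ i j, g i j - h i j ∈ 𝔞 := by
  rw [MonoidHom.mem_ker, map_mul, map_inv, inv_mul_eq_one, Matrix.SpecialLinearGroup.ext_iff]
  simp only [Matrix.SpecialLinearGroup.map_apply_coe, RingHom.mapMatrix_apply, Matrix.map_apply,
    Ideal.Quotient.mk_eq_mk_iff_sub_mem]

end SpecialLinear

section Dedekind

open scoped nonZeroDivisors

variable {R K : Type*} [CommRing R] [IsDedekindDomain R] [Field K] [Algebra R K]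
  [IsFractionRing R K]

/-- Multiplying a nonzero fractional ideal by an ideal `𝔞` gives a subgroup of index `N(𝔞)`. -/
lemma relIndex_coeIdeal_mul [Module.Free ℤ R] [Module.Finite ℤ R] (𝔞 : Ideal R)
    (T : FractionalIdeal R⁰ K) (hT : T ≠ 0) :
    (((𝔞 : FractionalIdeal R⁰ K) * T : FractionalIdeal R⁰ K) : Submodule R K).toAddSubgroup.relIndex
      (T : Submodule R K).toAddSubgroup = Ideal.absNorm 𝔞 := by
  obtain ⟨k, 𝔠, hk, rfl⟩ := FractionalIdeal.exists_eq_spanSingleton_mul T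
  have hk' : (algebraMap R K k)⁻¹ ≠ 0 :=
    inv_ne_zero ((map_ne_zero_iff _ (IsFractionRing.injective R K)).2 hk)
  have h𝔠 : 𝔠 ≠ ⊥ := by
    rintro rfl
    simp at hT
  let f : R →+ K := (AddMonoidHom.mulLeft (algebraMap R K k)⁻¹).comp (algebraMap R K)
  have hf : Function.Injective f :=
    (mul_right_injective₀ hk').comp (IsFractionRing.injective R K)
  have key : ∀ 𝔟 : Ideal R,
      ((FractionalIdeal.spanSingleton R⁰ (algebraMap R K k)⁻¹ * (𝔟 : FractionalIdeal R⁰ K) :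
        FractionalIdeal R⁰ K) : Submodule R K).toAddSubgroup
        = (Submodule.toAddSubgroup 𝔟).map f := by
    intro 𝔟
    ext x
    rw [Submodule.mem_toAddSubgroup, FractionalIdeal.mem_coe, FractionalIdeal.mem_singleton_mul]
    constructor
    · rintro ⟨y, hy, rfl⟩
      obtain ⟨z, hz, rfl⟩ := (FractionalIdeal.mem_coeIdeal _).1 hy
      exact ⟨z, hz, rfl⟩
    · rintro ⟨z, hz, rfl⟩
      exact ⟨_, FractionalIdeal.mem_coeIdeal_of_mem _ hz, rfl⟩
  rw [mul_left_comm, ← FractionalIdeal.coeIdeal_mul, key, key,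
    AddSubgroup.relIndex_map_map_of_injective _ _ hf]
  have h1 := AddSubgroup.relIndex_mul_index
    (show Submodule.toAddSubgroup (𝔞 * 𝔠) ≤ Submodule.toAddSubgroup 𝔠 from
      fun _ hx => Ideal.mul_le_right (I := 𝔞) hx)
  have h2 : ∀ 𝔟 : Ideal R, (Submodule.toAddSubgroup 𝔟).index = Ideal.absNorm 𝔟 := fun 𝔟 => rfl
  rw [h2, h2, map_mul] at h1
  exact Nat.eq_of_mul_eq_mul_right
    (Nat.pos_of_ne_zero (mt Ideal.absNorm_eq_zero_iff.1 h𝔠)) h1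

/-- The fractional ideal `(a, b)`. -/
def pairIdeal (R : Type*) {K : Type*} [CommRing R] [IsDedekindDomain R] [Field K] [Algebra R K]
    [IsFractionRing R K] (a b : K) : FractionalIdeal R⁰ K :=
  FractionalIdeal.spanSingleton R⁰ a + FractionalIdeal.spanSingleton R⁰ b

lemma mem_pairIdeal {a b x : K} :
    x ∈ pairIdeal R a b ↔ ∃ r s : R, algebraMap R K r * a + algebraMap R K s * b = x := by
  simp only [pairIdeal, FractionalIdeal.mem_add, FractionalIdeal.mem_spanSingleton,
    Algebra.smul_def]
  constructor
  · rintro ⟨_, ⟨r, rfl⟩, _, ⟨s, rfl⟩, h⟩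
    exact ⟨r, s, h⟩
  · rintro ⟨r, s, h⟩
    exact ⟨_, ⟨r, rfl⟩, _, ⟨s, rfl⟩, h⟩

lemma left_mem_pairIdeal (a b : K) : a ∈ pairIdeal R a b := mem_pairIdeal.2 ⟨1, 0, by simp⟩

lemma right_mem_pairIdeal (a b : K) : b ∈ pairIdeal R a b := mem_pairIdeal.2 ⟨0, 1, by simp⟩

lemma pairIdeal_ne_zero {a b : K} (h : a ≠ 0 ∨ b ≠ 0) : pairIdeal R a b ≠ 0 := by
  intro h0
  have ha := left_mem_pairIdeal (R := R) a b
  have hb := right_mem_pairIdeal (R := R) a b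
  rw [h0, FractionalIdeal.mem_zero_iff] at ha hb
  tauto

lemma pairIdeal_mul_left (c a b : K) :
    pairIdeal R (c * a) (c * b) = FractionalIdeal.spanSingleton R⁰ c * pairIdeal R a b := by
  simp only [pairIdeal, mul_add, FractionalIdeal.spanSingleton_mul_spanSingleton]

lemma pairIdeal_le {a b : K} {I : FractionalIdeal R⁰ K} (ha : a ∈ I) (hb : b ∈ I) :
    pairIdeal R a b ≤ I := by
  rw [pairIdeal, ← FractionalIdeal.sup_eq_add]
  exact sup_le (FractionalIdeal.spanSingleton_le_iff_mem.2 ha)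
    (FractionalIdeal.spanSingleton_le_iff_mem.2 hb)

/-- Generators of a nonzero fractional ideal `(a, b)` satisfy a Bézout identity with coefficients
in the inverse ideal. -/
lemma exists_bezout {a b : K} (h : a ≠ 0 ∨ b ≠ 0) :
    ∃ α ∈ (pairIdeal R a b)⁻¹, ∃ β ∈ (pairIdeal R a b)⁻¹, a * α + b * β = 1 := by
  have h1 : (1 : K) ∈ pairIdeal R a b * (pairIdeal R a b)⁻¹ := by
    rw [mul_inv_cancel₀ (pairIdeal_ne_zero h)]
    exact FractionalIdeal.one_mem_one _
  nth_rewrite 1 [pairIdeal] at h1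
  rw [add_mul, FractionalIdeal.mem_add] at h1
  obtain ⟨_, hx, _, hy, hxy⟩ := h1
  obtain ⟨α, hα, rfl⟩ := FractionalIdeal.mem_singleton_mul.1 hx
  obtain ⟨β, hβ, rfl⟩ := FractionalIdeal.mem_singleton_mul.1 hy
  exact ⟨α, hα, β, hβ, hxy⟩

lemma mul_mem_one {I : FractionalIdeal R⁰ K} (hI : I ≠ 0) {x y : K} (hx : x ∈ I) (hy : y ∈ I⁻¹) :
    ∃ r : R, algebraMap R K r = x * y := by
  have := FractionalIdeal.mul_mem_mul hx hy
  rw [mul_inv_cancel₀ hI] at this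
  exact (FractionalIdeal.mem_one_iff _).1 this

/-- Membership in `𝔠 · (a, b)⁻²`. -/
lemma mem_mul_inv_sq {a b : K} (h : a ≠ 0 ∨ b ≠ 0) (𝔠 : FractionalIdeal R⁰ K) (t : K) :
    t ∈ 𝔠 * ((pairIdeal R a b)⁻¹ * (pairIdeal R a b)⁻¹) ↔
      a * a * t ∈ 𝔠 ∧ a * b * t ∈ 𝔠 ∧ b * b * t ∈ 𝔠 := by
  have hI := pairIdeal_ne_zero (R := R) h
  constructor
  · intro ht
    have key : ∀ x ∈ pairIdeal R a b, ∀ y ∈ pairIdeal R a b, x * y * t ∈ 𝔠 := by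
      intro x hx y hy
      have := FractionalIdeal.mul_mem_mul (FractionalIdeal.mul_mem_mul hx hy) ht
      rwa [mul_left_comm, ← mul_inv, mul_inv_cancel₀ (mul_ne_zero hI hI), mul_one] at this
    exact ⟨key _ (left_mem_pairIdeal _ _) _ (left_mem_pairIdeal _ _),
      key _ (left_mem_pairIdeal _ _) _ (right_mem_pairIdeal _ _),
      key _ (right_mem_pairIdeal _ _) _ (right_mem_pairIdeal _ _)⟩
  · rintro ⟨h1, h2, h3⟩
    obtain ⟨α, hα, β, hβ, hab⟩ := exists_bezout (R := R) h
    have key : ∀ x ∈ 𝔠, ∀ γ ∈ (pairIdeal R a b)⁻¹, ∀ δ ∈ (pairIdeal R a b)⁻¹,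
        x * (γ * δ) ∈ 𝔠 * ((pairIdeal R a b)⁻¹ * (pairIdeal R a b)⁻¹) := fun x hx γ hγ δ hδ =>
      FractionalIdeal.mul_mem_mul hx (FractionalIdeal.mul_mem_mul hγ hδ)
    have ht : t = a * a * t * (α * α) + a * b * t * (α * β) + a * b * t * (α * β)
        + b * b * t * (β * β) := by
      linear_combination (-t) * (a * α + b * β + 1) * hab
    rw [ht, ← FractionalIdeal.mem_coe]
    exact Submodule.add_mem _ (Submodule.add_mem _ (Submodule.add_mem _
      (key _ h1 _ hα _ hα) (key _ h2 _ hα _ hβ))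
      (key _ h2 _ hα _ hβ)) (key _ h3 _ hβ _ hβ)

lemma exists_isTriangularIn {a b α β : K} (h : a ≠ 0 ∨ b ≠ 0)
    (hα : α ∈ (pairIdeal R a b)⁻¹) (hβ : β ∈ (pairIdeal R a b)⁻¹) (hab : a * α + b * β = 1)
    {g : SL(2, R)} {c : K}
    (h1 : algebraMap R K (g 0 0) * a + algebraMap R K (g 0 1) * b = c * a)
    (h2 : algebraMap R K (g 1 0) * a + algebraMap R K (g 1 1) * b = c * b) :
    ∃ (u : Rˣ) (t : K), t ∈ (pairIdeal R a b)⁻¹ * (pairIdeal R a b)⁻¹ ∧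
      IsTriangularIn a b α β g u t := by
  have hI := pairIdeal_ne_zero (R := R) h
  obtain ⟨aα, haα⟩ := mul_mem_one hI (left_mem_pairIdeal a b) hα
  obtain ⟨aβ, haβ⟩ := mul_mem_one hI (left_mem_pairIdeal a b) hβ
  obtain ⟨bα, hbα⟩ := mul_mem_one hI (right_mem_pairIdeal a b) hα
  obtain ⟨bβ, hbβ⟩ := mul_mem_one hI (right_mem_pairIdeal a b) hβ
  have hdet := map_det_eq_one (K := K) g
  have hinj := IsFractionRing.injective R K
  obtain ⟨u, hu⟩ : ∃ u : R, algebraMap R K u = c := by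
    refine ⟨g 0 0 * aα + g 0 1 * bα + g 1 0 * aβ + g 1 1 * bβ, ?_⟩
    simp only [map_add, map_mul, haα, haβ, hbα, hbβ]
    linear_combination α * h1 + β * h2 + c * hab
  have huv : u * (g 0 0 + g 1 1 - u) = 1 := by
    apply hinj
    simp only [map_add, map_mul, map_sub, map_one, hu]
    generalize algebraMap R K (g 0 0) = p at *
    generalize algebraMap R K (g 0 1) = q at *
    generalize algebraMap R K (g 1 0) = r at *
    generalize algebraMap R K (g 1 1) = s at *
    linear_combination hdet + ((p - c) * (s - c) - q * r) * hab
      - α * ((s - c) * h1 - q * h2) - β * ((p - c) * h2 - r * h1)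
  let t : K := α * α * algebraMap R K (g 0 1) - β * β * algebraMap R K (g 1 0)
    + α * β * (algebraMap R K (g 1 1) - algebraMap R K (g 0 0))
  have htri : IsTriangularIn a b α β g ⟨u, g 0 0 + g 1 1 - u, huv, by rw [mul_comm, huv]⟩ t := by
    constructor <;> simp only [Units.inv_mk, map_add, map_sub, hu, t] <;>
      clear huv hu haα haβ hbα hbβ hinj t hI hα hβ <;>
      generalize algebraMap R K (g 0 0) = p at * <;>
      generalize algebraMap R K (g 0 1) = q at * <;>
      generalize algebraMap R K (g 1 0) = r at * <;>
      generalize algebraMap R K (g 1 1) = s at * <;>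
      grind
  refine ⟨_, t, ?_, htri⟩
  rw [← one_mul ((pairIdeal R a b)⁻¹ * _), mem_mul_inv_sq h]
  obtain ⟨e1, e2, e3, -⟩ := htri
  rw [← haα, ← hbβ] at e1
  rw [← haβ] at e2
  rw [← hbα] at e3
  simp only [FractionalIdeal.mem_one_iff]
  refine ⟨⟨g 0 1 - (u - (g 0 0 + g 1 1 - u)) * aβ, ?_⟩,
    ⟨u * aα + (g 0 0 + g 1 1 - u) * bβ - g 0 0, ?_⟩,
    ⟨(u - (g 0 0 + g 1 1 - u)) * bα - g 1 0, ?_⟩⟩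
  · simp only [Units.inv_mk, map_sub, map_mul, map_add] at e2 ⊢
    linear_combination e2
  · simp only [Units.inv_mk, map_sub, map_mul, map_add] at e1 ⊢
    linear_combination -e1
  · simp only [Units.inv_mk, map_sub, map_mul, map_add] at e3 ⊢
    linear_combination -e3

lemma exists_of_isTriangularIn {a b α β : K} (h : a ≠ 0 ∨ b ≠ 0)
    (hα : α ∈ (pairIdeal R a b)⁻¹) (hβ : β ∈ (pairIdeal R a b)⁻¹) (hab : a * α + b * β = 1)
    (u : Rˣ) {t : K} (ht : t ∈ (pairIdeal R a b)⁻¹ * (pairIdeal R a b)⁻¹) :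
    ∃ g : SL(2, R), IsTriangularIn a b α β g u t := by
  have hI := pairIdeal_ne_zero (R := R) h
  obtain ⟨aα, haα⟩ := mul_mem_one hI (left_mem_pairIdeal a b) hα
  obtain ⟨aβ, haβ⟩ := mul_mem_one hI (left_mem_pairIdeal a b) hβ
  obtain ⟨bα, hbα⟩ := mul_mem_one hI (right_mem_pairIdeal a b) hα
  obtain ⟨bβ, hbβ⟩ := mul_mem_one hI (right_mem_pairIdeal a b) hβ
  rw [← one_mul ((pairIdeal R a b)⁻¹ * _), mem_mul_inv_sq h] at ht
  simp only [FractionalIdeal.mem_one_iff] at ht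
  obtain ⟨⟨x, hx⟩, ⟨y, hy⟩, ⟨z, hz⟩⟩ := ht
  have huv := map_mul_map_inv (K := K) u
  have hdet : (!![u * aα + ↑u⁻¹ * bβ - y, (u - ↑u⁻¹) * aβ + x;
      (u - ↑u⁻¹) * bα - z, u * bβ + ↑u⁻¹ * aα + y] : Matrix (Fin 2) (Fin 2) R).det = 1 := by
    rw [Matrix.det_fin_two_of]
    apply IsFractionRing.injective R K
    simp only [map_add, map_mul, map_sub, map_one, haα, haβ, hbα, hbβ, hx, hy, hz]
    generalize algebraMap R K (u : R) = v at *
    generalize algebraMap R K (↑u⁻¹ : R) = w at *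
    linear_combination huv * (a * α + b * β) ^ 2 + (a * α + b * β + 1) * hab
  refine ⟨⟨_, hdet⟩, ?_, ?_, ?_, ?_⟩ <;>
    simp [haα, haβ, hbα, hbβ, hx, hy, hz]

lemma inv_mul_mem_ker_map_iff_of_isTriangularIn {a b α β : K} (h : a ≠ 0 ∨ b ≠ 0)
    (hα : α ∈ (pairIdeal R a b)⁻¹) (hβ : β ∈ (pairIdeal R a b)⁻¹) (hab : a * α + b * β = 1)
    {𝔞 : Ideal R} (hsep : ∀ u v : Rˣ, (u : R) - v ∈ 𝔞 → u = v)
    {g k : SL(2, R)} {u v : Rˣ} {t s : K}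
    (hg : IsTriangularIn a b α β g u t) (hk : IsTriangularIn a b α β k v s) :
    g⁻¹ * k ∈ (Matrix.SpecialLinearGroup.map (n := Fin 2) (Ideal.Quotient.mk 𝔞)).ker ↔
      u = v ∧ t - s ∈ (𝔞 : FractionalIdeal R⁰ K) *
        ((pairIdeal R a b)⁻¹ * (pairIdeal R a b)⁻¹) := by
  rw [inv_mul_mem_ker_map_iff, mem_mul_inv_sq h]
  constructor
  · intro hgk
    have huv : u = v := by
      have hI := pairIdeal_ne_zero (R := R) h
      obtain ⟨aα, haα⟩ := mul_mem_one hI (left_mem_pairIdeal a b) hα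
      obtain ⟨aβ, haβ⟩ := mul_mem_one hI (left_mem_pairIdeal a b) hβ
      obtain ⟨bα, hbα⟩ := mul_mem_one hI (right_mem_pairIdeal a b) hα
      obtain ⟨bβ, hbβ⟩ := mul_mem_one hI (right_mem_pairIdeal a b) hβ
      apply hsep
      have : (u : R) - v = (g 0 0 - k 0 0) * aα + (g 0 1 - k 0 1) * bα
          + (g 1 0 - k 1 0) * aβ + (g 1 1 - k 1 1) * bβ := by
        apply IsFractionRing.injective R K
        simp only [map_sub, map_add, map_mul, haα, haβ, hbα, hbβ]
        obtain ⟨g1, g2⟩ := hg.mul_left_eq hab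
        obtain ⟨k1, k2⟩ := hk.mul_left_eq hab
        linear_combination α * k1 + β * k2 - α * g1 - β * g2
          - (algebraMap R K u - algebraMap R K v) * hab
      rw [this]
      exact add_mem (add_mem (add_mem (𝔞.mul_mem_right _ (hgk 0 0)) (𝔞.mul_mem_right _ (hgk 0 1)))
        (𝔞.mul_mem_right _ (hgk 1 0))) (𝔞.mul_mem_right _ (hgk 1 1))
    subst huv
    have e1 : a * a * (t - s) = algebraMap R K (g 0 1 - k 0 1) := by
      rw [map_sub, hg.apply_zero_one, hk.apply_zero_one]; ring
    have e2 : a * b * (t - s) = algebraMap R K (g 1 1 - k 1 1) := by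
      rw [map_sub, hg.apply_one_one, hk.apply_one_one]; ring
    have e3 : b * b * (t - s) = algebraMap R K (-(g 1 0 - k 1 0)) := by
      rw [map_neg, map_sub, hg.apply_one_zero, hk.apply_one_zero]; ring
    rw [e1, e2, e3]
    exact ⟨rfl, map_mem_coeIdeal.2 (hgk 0 1), map_mem_coeIdeal.2 (hgk 1 1),
      map_mem_coeIdeal.2 (neg_mem (hgk 1 0))⟩
  · rintro ⟨rfl, h1, h2, h3⟩
    rw [show a * a * (t - s) = algebraMap R K (g 0 1 - k 0 1) by
      rw [map_sub, hg.apply_zero_one, hk.apply_zero_one]; ring, map_mem_coeIdeal] at h1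
    rw [show b * b * (t - s) = algebraMap R K (k 1 0 - g 1 0) by
      rw [map_sub, hg.apply_one_zero, hk.apply_one_zero]; ring, map_mem_coeIdeal] at h3
    have h4 := h2
    rw [show a * b * (t - s) = algebraMap R K (g 1 1 - k 1 1) by
      rw [map_sub, hg.apply_one_one, hk.apply_one_one]; ring, map_mem_coeIdeal] at h2
    rw [show a * b * (t - s) = algebraMap R K (k 0 0 - g 0 0) by
      rw [map_sub, hg.apply_zero_zero, hk.apply_zero_zero]; ring, map_mem_coeIdeal] at h4
    intro i j
    fin_cases i <;> fin_cases j
    · exact sub_mem_comm_iff.1 h4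
    · exact h1
    · exact sub_mem_comm_iff.1 h3
    · exact h2

/-- The principal congruence subgroup of a sufficiently deep level `𝔞` meets the stabilizer of the
line through `(a, b)` in a subgroup of index `#Rˣ · N(𝔞)`. -/
lemma relIndex_ker_map_of_stabilizes [Module.Free ℤ R] [Module.Finite ℤ R] {a b : K}
    (h : a ≠ 0 ∨ b ≠ 0) {𝔞 : Ideal R} (hsep : ∀ u v : Rˣ, (u : R) - v ∈ 𝔞 → u = v)
    (S : Subgroup SL(2, R))
    (hS : ∀ g, g ∈ S ↔ ∃ c : K,
      algebraMap R K (g 0 0) * a + algebraMap R K (g 0 1) * b = c * a ∧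
      algebraMap R K (g 1 0) * a + algebraMap R K (g 1 1) * b = c * b) :
    (Matrix.SpecialLinearGroup.map (n := Fin 2) (Ideal.Quotient.mk 𝔞)).ker.relIndex S =
      Nat.card Rˣ * Ideal.absNorm 𝔞 := by
  obtain ⟨α, hα, β, hβ, hab⟩ := exists_bezout (R := R) h
  have hex : ∀ g : S, ∃ (u : Rˣ) (t : ((((pairIdeal R a b)⁻¹ * (pairIdeal R a b)⁻¹ :
      FractionalIdeal R⁰ K) : Submodule R K).toAddSubgroup)),
      IsTriangularIn a b α β (g : SL(2, R)) u (t : K) := by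
    intro g
    obtain ⟨c, h1, h2⟩ := (hS g).1 g.2
    obtain ⟨u, t, ht, htri⟩ := exists_isTriangularIn h hα hβ hab h1 h2
    exact ⟨u, ⟨t, ht⟩, htri⟩
  choose u t htri using hex
  have hJ : (pairIdeal R a b)⁻¹ * (pairIdeal R a b)⁻¹ ≠ 0 :=
    mul_ne_zero (inv_ne_zero (pairIdeal_ne_zero h)) (inv_ne_zero (pairIdeal_ne_zero h))
  rw [← relIndex_coeIdeal_mul 𝔞 _ hJ, Subgroup.relIndex, AddSubgroup.relIndex, Subgroup.index,
    AddSubgroup.index, ← Nat.card_prod]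
  have hf : ∀ g k : S, (u g, (QuotientAddGroup.mk (t g) :
      _ ⧸ ((((𝔞 : FractionalIdeal R⁰ K) * ((pairIdeal R a b)⁻¹ * (pairIdeal R a b)⁻¹) :
        FractionalIdeal R⁰ K) : Submodule R K).toAddSubgroup.addSubgroupOf
      (((pairIdeal R a b)⁻¹ * (pairIdeal R a b)⁻¹ :
        FractionalIdeal R⁰ K) : Submodule R K).toAddSubgroup))) =
      (u k, QuotientAddGroup.mk (t k)) ↔ g⁻¹ * k ∈
        (Matrix.SpecialLinearGroup.map (n := Fin 2) (Ideal.Quotient.mk 𝔞)).ker.subgroupOf S := by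
    intro g k
    rw [Prod.mk.injEq, eq_comm (a := QuotientAddGroup.mk (t g)), QuotientAddGroup.eq,
      AddSubgroup.mem_addSubgroupOf, Subgroup.mem_subgroupOf]
    refine Iff.trans ?_ (inv_mul_mem_ker_map_iff_of_isTriangularIn h hα hβ hab hsep
      (htri g) (htri k)).symm
    rw [sub_eq_neg_add]
    rfl
  refine Nat.card_eq_of_bijective (Quotient.lift (fun g => (u g, QuotientAddGroup.mk (t g)))
    fun g k hgk => (hf g k).2 (QuotientGroup.leftRel_apply.1 hgk)) ⟨?_, ?_⟩
  · rintro ⟨g⟩ ⟨k⟩ hgk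
    exact Quotient.sound' (QuotientGroup.leftRel_apply.2 ((hf g k).1 hgk))
  · rintro ⟨v, ⟨s⟩⟩
    obtain ⟨g, hg⟩ := exists_of_isTriangularIn h hα hβ hab v s.2
    have hgS : g ∈ S := (hS g).2 ⟨_, hg.mul_left_eq hab⟩
    refine ⟨Quotient.mk'' ⟨g, hgS⟩, ?_⟩
    have := (inv_mul_mem_ker_map_iff_of_isTriangularIn h hα hβ hab hsep (htri ⟨g, hgS⟩) hg).1
      (by simp [one_mem])
    refine Prod.ext this.1 ?_
    refine Eq.symm (QuotientAddGroup.eq.2 ?_)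
    rw [AddSubgroup.mem_addSubgroupOf]
    have h2 := this.2
    rw [sub_eq_neg_add] at h2
    exact h2

lemma pairIdeal_map_apply (g : SL(2, R)) (a b : K) :
    pairIdeal R (algebraMap R K (g 0 0) * a + algebraMap R K (g 0 1) * b)
      (algebraMap R K (g 1 0) * a + algebraMap R K (g 1 1) * b) = pairIdeal R a b := by
  have hdet := map_det_eq_one (K := K) g
  refine le_antisymm (pairIdeal_le (mem_pairIdeal.2 ⟨_, _, rfl⟩) (mem_pairIdeal.2 ⟨_, _, rfl⟩))
    (pairIdeal_le (mem_pairIdeal.2 ⟨g 1 1, -g 0 1, ?_⟩) (mem_pairIdeal.2 ⟨-g 1 0, g 0 0, ?_⟩))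
  · rw [map_neg]
    linear_combination a * hdet
  · rw [map_neg]
    linear_combination b * hdet

lemma exists_map_apply_eq_of_pairIdeal_eq {a b c d : K} (hab : a ≠ 0 ∨ b ≠ 0)
    (hcd : c ≠ 0 ∨ d ≠ 0) (h : pairIdeal R a b = pairIdeal R c d) :
    ∃ g : SL(2, R), algebraMap R K (g 0 0) * a + algebraMap R K (g 0 1) * b = c ∧
      algebraMap R K (g 1 0) * a + algebraMap R K (g 1 1) * b = d := by
  have hI := pairIdeal_ne_zero (R := R) hab
  obtain ⟨α, hα, β, hβ, h1⟩ := exists_bezout (R := R) hab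
  obtain ⟨γ, hγ, δ, hδ, h2⟩ := exists_bezout (R := R) hcd
  rw [← h] at hγ hδ
  have ha := left_mem_pairIdeal (R := R) a b
  have hb := right_mem_pairIdeal (R := R) a b
  have hc := left_mem_pairIdeal (R := R) c d
  have hd := right_mem_pairIdeal (R := R) c d
  rw [← h] at hc hd
  obtain ⟨cα, hcα⟩ := mul_mem_one hI hc hα
  obtain ⟨cβ, hcβ⟩ := mul_mem_one hI hc hβ
  obtain ⟨dα, hdα⟩ := mul_mem_one hI hd hα
  obtain ⟨dβ, hdβ⟩ := mul_mem_one hI hd hβ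
  obtain ⟨aγ, haγ⟩ := mul_mem_one hI ha hγ
  obtain ⟨aδ, haδ⟩ := mul_mem_one hI ha hδ
  obtain ⟨bγ, hbγ⟩ := mul_mem_one hI hb hγ
  obtain ⟨bδ, hbδ⟩ := mul_mem_one hI hb hδ
  have hdet : (!![cα + bδ, cβ - aδ; dα - bγ, dβ + aγ] : Matrix (Fin 2) (Fin 2) R).det = 1 := by
    rw [Matrix.det_fin_two_of]
    apply IsFractionRing.injective R K
    simp only [map_add, map_mul, map_sub, map_one, hcα, hcβ, hdα, hdβ, haγ, haδ, hbγ, hbδ]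
    linear_combination (c * γ + d * δ) * h1 + h2
  refine ⟨⟨_, hdet⟩, ?_, ?_⟩
  · simp only [Matrix.of_apply, Matrix.cons_val', Matrix.cons_val_zero,
      Matrix.cons_val_one, map_add, map_sub, hcα, hcβ, haδ, hbδ]
    linear_combination c * h1
  · simp only [Matrix.of_apply, Matrix.cons_val', Matrix.cons_val_zero,
      Matrix.cons_val_one, map_add, map_sub, hdα, hdβ, haγ, hbγ]
    linear_combination d * h1

/-- The ideal class of `(a, b)`. -/
def pairClass (R : Type*) {K : Type*} [CommRing R] [IsDedekindDomain R] [Field K] [Algebra R K]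
    [IsFractionRing R K] (a b : K) (h : a ≠ 0 ∨ b ≠ 0) : ClassGroup R :=
  ClassGroup.mk K (Units.mk0 (pairIdeal R a b) (pairIdeal_ne_zero h))

lemma pairClass_eq_iff {a b c d : K} (hab : a ≠ 0 ∨ b ≠ 0) (hcd : c ≠ 0 ∨ d ≠ 0) :
    pairClass R a b hab = pairClass R c d hcd ↔
      ∃ x : K, x ≠ 0 ∧ pairIdeal R a b = FractionalIdeal.spanSingleton R⁰ x * pairIdeal R c d := by
  have h1 := pairIdeal_ne_zero (R := R) hab
  have h2 := pairIdeal_ne_zero (R := R) hcd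
  rw [pairClass, pairClass, ← div_eq_one, ← map_div, ClassGroup.mk_eq_one_iff,
    FractionalIdeal.isPrincipal_iff]
  simp only [Units.val_div_eq_div_val, Units.val_mk0, div_eq_iff h2]
  refine exists_congr fun x => ⟨fun hx => ⟨?_, hx⟩, And.right⟩
  rintro rfl
  simp [h1] at hx

lemma exists_pairClass_eq (C : ClassGroup R) :
    ∃ (a b : K) (h : a ≠ 0 ∨ b ≠ 0), pairClass R a b h = C := by
  obtain ⟨I, rfl⟩ := ClassGroup.mk0_surjective C
  have hI : (I : Ideal R) ≠ 0 := nonZeroDivisors.coe_ne_zero I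
  obtain ⟨r, hr, hr0⟩ := Submodule.exists_mem_ne_zero_of_ne_bot hI
  obtain ⟨s, hs⟩ := IsDedekindDomain.exists_sup_span_eq
    ((Ideal.span_singleton_le_iff_mem _).2 hr) (by simpa using hr0)
  refine ⟨algebraMap R K r, algebraMap R K s,
    Or.inl ((map_ne_zero_iff _ (IsFractionRing.injective R K)).2 hr0), ?_⟩
  rw [pairClass, ← ClassGroup.mk_mk0 K]
  congr 1
  ext1
  rw [Units.val_mk0, FractionalIdeal.coe_mk0, ← hs, FractionalIdeal.coeIdeal_sup,
    FractionalIdeal.coeIdeal_span_singleton, FractionalIdeal.coeIdeal_span_singleton, pairIdeal]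

end Dedekind

section Cusps

variable {D : ℕ}

lemma apply_ne_zero_or {K : Type*} [Field K] {v : Fin 2 → K} (hv : v ≠ 0) :
    v 0 ≠ 0 ∨ v 1 ≠ 0 := by
  by_contra! h
  exact hv (funext fun i => by fin_cases i <;> simp [h.1, h.2])

lemma smul_mk_eq_mk_iff (g : SL(2, 𝓞 (F D))) {v w : Fin 2 → F D} (hv : v ≠ 0) (hw : w ≠ 0) :
    g • (Projectivization.mk (F D) v hv : P1 D) = Projectivization.mk (F D) w hw ↔
      ∃ c : F D, algebraMap (𝓞 (F D)) (F D) (g 0 0) * v 0 + algebraMap (𝓞 (F D)) (F D) (g 0 1) * v 1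
          = c * w 0 ∧
        algebraMap (𝓞 (F D)) (F D) (g 1 0) * v 0 + algebraMap (𝓞 (F D)) (F D) (g 1 1) * v 1
          = c * w 1 := by
  change toSLF D g • (Projectivization.mk (F D) v hv) = _ ↔ _
  rw [smul_mk, Projectivization.mk_eq_mk_iff']
  refine exists_congr fun c => ?_
  rw [funext_iff, Fin.forall_fin_two]
  simp [toSLF, Matrix.mulVec, dotProduct, Fin.sum_univ_two, eq_comm]

lemma mk_mem_orbit_iff {v w : Fin 2 → F D} (hv : v ≠ 0) (hw : w ≠ 0) :
    (Projectivization.mk (F D) w hw : P1 D) ∈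
        MulAction.orbit SL(2, 𝓞 (F D)) (Projectivization.mk (F D) v hv : P1 D) ↔
      pairClass (𝓞 (F D)) (v 0) (v 1) (apply_ne_zero_or hv) =
        pairClass (𝓞 (F D)) (w 0) (w 1) (apply_ne_zero_or hw) := by
  rw [pairClass_eq_iff, MulAction.mem_orbit_iff]
  simp only [smul_mk_eq_mk_iff]
  constructor
  · rintro ⟨g, c, h0, h1⟩
    have h := pairIdeal_map_apply g (v 0) (v 1)
    rw [h0, h1, pairIdeal_mul_left] at h
    refine ⟨c, ?_, h.symm⟩
    rintro rfl
    rw [FractionalIdeal.spanSingleton_zero, zero_mul] at h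
    exact pairIdeal_ne_zero (apply_ne_zero_or hv) h.symm
  · rintro ⟨c, hc, h⟩
    rw [← pairIdeal_mul_left] at h
    obtain ⟨g, hg⟩ := exists_map_apply_eq_of_pairIdeal_eq (apply_ne_zero_or hv)
      ((apply_ne_zero_or hw).imp (mul_ne_zero hc) (mul_ne_zero hc)) h
    exact ⟨g, c, hg⟩

/-- The cusps of the full Bianchi group correspond to the ideal classes. -/
lemma exists_orbits_equiv_classGroup (D : ℕ) :
    Nonempty (MulAction.orbitRel.Quotient SL(2, 𝓞 (F D)) (P1 D) ≃ ClassGroup (𝓞 (F D))) := by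
  let f : P1 D → ClassGroup (𝓞 (F D)) := fun x =>
    pairClass (𝓞 (F D)) (x.rep 0) (x.rep 1) (apply_ne_zero_or x.rep_nonzero)
  have hf : ∀ x y : P1 D, f x = f y ↔ MulAction.orbitRel SL(2, 𝓞 (F D)) (P1 D) x y := by
    intro x y
    rw [MulAction.orbitRel_apply, eq_comm]
    have := mk_mem_orbit_iff y.rep_nonzero x.rep_nonzero
    rw [Projectivization.mk_rep, Projectivization.mk_rep] at this
    exact this.symm
  refine ⟨Equiv.ofBijective (Quotient.lift f fun x y h => (hf x y).2 h) ⟨?_, ?_⟩⟩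
  · rintro ⟨x⟩ ⟨y⟩ h
    exact Quotient.sound' ((hf x y).1 h)
  · intro C
    obtain ⟨a, b, h, rfl⟩ := exists_pairClass_eq (K := F D) C
    have hv : (![a, b] : Fin 2 → F D) ≠ 0 := by
      intro h0
      have h1 := congrFun h0 0
      have h2 := congrFun h0 1
      simp at h1 h2
      tauto
    refine ⟨Quotient.mk'' (Projectivization.mk (F D) ![a, b] hv), ?_⟩
    refine ((mk_mem_orbit_iff (Projectivization.rep_nonzero _) hv).1 ?_)
    rw [Projectivization.mk_rep]
    exact MulAction.mem_orbit_self _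

lemma mem_stabilizer_mk_iff (g : SL(2, 𝓞 (F D))) {v : Fin 2 → F D} (hv : v ≠ 0) :
    g ∈ MulAction.stabilizer SL(2, 𝓞 (F D)) (Projectivization.mk (F D) v hv : P1 D) ↔
      ∃ c : F D, algebraMap (𝓞 (F D)) (F D) (g 0 0) * v 0 + algebraMap (𝓞 (F D)) (F D) (g 0 1) * v 1
          = c * v 0 ∧
        algebraMap (𝓞 (F D)) (F D) (g 1 0) * v 0 + algebraMap (𝓞 (F D)) (F D) (g 1 1) * v 1
          = c * v 1 := by
  rw [MulAction.mem_stabilizer_iff, smul_mk_eq_mk_iff]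

lemma relIndex_Gamma_stabilizer {𝔞 : Ideal (𝓞 (F D))}
    (hsep : ∀ u v : (𝓞 (F D))ˣ, (u : 𝓞 (F D)) - v ∈ 𝔞 → u = v) (x : P1 D) :
    (Gamma D 𝔞).relIndex (MulAction.stabilizer SL(2, 𝓞 (F D)) x) =
      Nat.card (𝓞 (F D))ˣ * Ideal.absNorm 𝔞 := by
  induction x using Projectivization.ind with
  | h v hv =>
    exact relIndex_ker_map_of_stabilizes (apply_ne_zero_or hv) hsep _
      fun g => mem_stabilizer_mk_iff g hv

lemma conj_sqrtNeg (D : ℕ) : (starRingEnd ℂ) (sqrtNeg D) = -sqrtNeg D := by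
  simp [sqrtNeg]

lemma norm_embedding_eq (φ : F D →ₐ[ℚ] ℂ) (x : F D) : ‖φ x‖ = ‖(x : ℂ)‖ := by
  have hmem : sqrtNeg D ∈ F D := IntermediateField.mem_adjoin_simple_self ℚ _
  have hsq : φ ⟨sqrtNeg D, hmem⟩ ^ 2 = sqrtNeg D ^ 2 := by
    rw [← map_pow, sqrtNeg_sq, show (⟨sqrtNeg D, hmem⟩ : F D) ^ 2 = -(D : F D) from
      Subtype.ext (by simpa using sqrtNeg_sq D)]
    simp
  rcases sq_eq_sq_iff_eq_or_eq_neg.1 hsq with h | h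
  · have : φ = (F D).val := IntermediateField.algHom_ext_of_eq_adjoin ℚ rfl fun y hy => by
      obtain rfl := Set.mem_singleton_iff.1 hy
      exact h
    rw [this]
    rfl
  · have : φ = ((Complex.conjAe.restrictScalars ℚ : ℂ ≃ₐ[ℚ] ℂ) : ℂ →ₐ[ℚ] ℂ).comp (F D).val :=
      IntermediateField.algHom_ext_of_eq_adjoin ℚ rfl fun y hy => by
        obtain rfl := Set.mem_singleton_iff.1 hy
        exact h.trans (conj_sqrtNeg D).symm
    rw [this]
    exact Complex.norm_conj (x : ℂ)

lemma norm_unit_eq_one (u : (𝓞 (F D))ˣ) : ‖(((u : 𝓞 (F D)) : F D) : ℂ)‖ = 1 := by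
  have h := congrArg norm (Algebra.norm_eq_prod_embeddings ℚ ℂ ((u : 𝓞 (F D)) : F D))
  rw [norm_prod, Finset.prod_congr rfl fun φ _ => norm_embedding_eq φ _, Finset.prod_const] at h
  have h1 : |Algebra.norm ℚ ((u : 𝓞 (F D)) : F D)| = 1 := by
    simp
  have h2 : ‖algebraMap ℚ ℂ (Algebra.norm ℚ ((u : 𝓞 (F D)) : F D))‖ = 1 := by
    rw [eq_ratCast, Complex.norm_ratCast]
    exact_mod_cast h1
  rw [h2] at h
  refine (pow_eq_one_iff_of_nonneg (norm_nonneg _) ?_).1 h.symm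
  have : Nonempty (F D →ₐ[ℚ] ℂ) := ⟨(F D).val⟩
  exact Finset.card_ne_zero.2 Finset.univ_nonempty

instance finite_units (D : ℕ) : Finite (𝓞 (F D))ˣ := by
  have hfin := NumberField.Embeddings.finite_of_norm_le (F D) ℂ 1
  let f : (𝓞 (F D))ˣ → {x : F D | IsIntegral ℤ x ∧ ∀ φ : F D →+* ℂ, ‖φ x‖ ≤ 1} := fun u =>
    ⟨((u : 𝓞 (F D)) : F D), RingOfIntegers.isIntegral_coe _, fun φ => by
      rw [← norm_unit_eq_one u, ← norm_embedding_eq (RingHom.equivRatAlgHom _ _ φ)]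
      rfl⟩
  have := hfin.to_subtype
  refine Finite.of_injective f fun u v huv => ?_
  exact Units.ext (RingOfIntegers.ext (Subtype.mk.inj huv))

/-- Modulo an ideal of large norm, distinct units are incongruent. -/
lemma exists_units_separated (D : ℕ) :
    ∃ C : ℝ, 0 < C ∧ ∀ 𝔞 : Ideal (𝓞 (F D)), C < (Ideal.absNorm 𝔞 : ℝ) →
      ∀ u v : (𝓞 (F D))ˣ, (u : 𝓞 (F D)) - v ∈ 𝔞 → u = v := by
  have := Fintype.ofFinite (𝓞 (F D))ˣ
  let n : (𝓞 (F D))ˣ × (𝓞 (F D))ˣ → ℕ := fun p =>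
    Ideal.absNorm (Ideal.span {(p.1 : 𝓞 (F D)) - p.2})
  refine ⟨((1 + ∑ p, n p : ℕ) : ℝ), by positivity, fun 𝔞 h𝔞 u v huv => ?_⟩
  by_contra hne
  have h0 : n (u, v) ≠ 0 := by
    intro h
    rw [Ideal.absNorm_eq_zero_iff, Ideal.span_singleton_eq_bot, sub_eq_zero] at h
    exact hne (Units.ext h)
  have h1 : Ideal.absNorm 𝔞 ≤ n (u, v) := Nat.le_of_dvd (Nat.pos_of_ne_zero h0)
    (Ideal.absNorm_dvd_absNorm_of_le ((Ideal.span_singleton_le_iff_mem _).2 huv))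
  have h2 : n (u, v) ≤ ∑ p, n p := Finset.single_le_sum (fun _ _ => Nat.zero_le _)
    (Finset.mem_univ _)
  have h3 : 1 + ∑ p, n p < Ideal.absNorm 𝔞 := by exact_mod_cast h𝔞
  omega

lemma finiteIndex_Gamma {𝔞 : Ideal (𝓞 (F D))} (h𝔞 : 𝔞 ≠ ⊥) : (Gamma D 𝔞).FiniteIndex := by
  have : Finite (𝓞 (F D) ⧸ 𝔞) := Ideal.finiteQuotientOfFreeOfNeBot 𝔞 h𝔞
  have : Finite SL(2, 𝓞 (F D) ⧸ 𝔞) := Finite.of_injective _ Subtype.val_injective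
  exact Subgroup.finiteIndex_ker _

end Cusps

/-- For `N(𝔞)` sufficiently large,
`κ(Γ(𝔞)) = d_F · [Γ(D) : Γ(𝔞)] / (#(O_D^×) · N(𝔞))`. -/
theorem statement_6 (D : ℕ) (hD : Squarefree D) (hD0 : 0 < D) :
    ∃ C : ℝ, 0 < C ∧ ∀ 𝔞 : Ideal (𝓞 (F D)), 𝔞 ≠ ⊥ → C < (Ideal.absNorm 𝔞 : ℝ) →
      cusps D (Gamma D 𝔞) * Nat.card ((𝓞 (F D))ˣ) * Ideal.absNorm 𝔞 =
        NumberField.classNumber (F D) * (Gamma D 𝔞).index := by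
  obtain ⟨C, hC, hsep⟩ := exists_units_separated D
  refine ⟨C, hC, fun 𝔞 h𝔞 hN => ?_⟩
  obtain ⟨e⟩ := exists_orbits_equiv_classGroup D
  have : Finite (MulAction.orbitRel.Quotient SL(2, 𝓞 (F D)) (P1 D)) := Finite.of_equiv _ e.symm
  have : (Gamma D 𝔞).FiniteIndex := finiteIndex_Gamma h𝔞
  have : (Gamma D 𝔞).Normal := MonoidHom.normal_ker _
  rw [cusps, mul_assoc, card_orbits_mul_of_relIndex_stabilizer (Gamma D 𝔞) _
    (relIndex_Gamma_stabilizer (hsep 𝔞 hN)), Nat.card_congr e, NumberField.classNumber,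
    Nat.card_eq_fintype_card]

end Bianchi
end
end

section
/- If γ ∈ SL₂(O_D) fixes some point η ∈ ℙ¹(F), then there is a unit u ∈ O_D^× such that the characteristic polynomial of γ equals (X − u)(X − u⁻¹); in particular, the eigenvalues of γ lie in the unit group O_D^× of O_D. -/
open scoped MatrixGroups

set_option maxHeartbeats 1000000
set_option synthInstance.maxHeartbeats 400000

noncomputable section

namespace Bianchi

open NumberField MvPolynomial Finsupp

/-- Over an integrally closed domain `R`, if a matrix in `SL(2, R)` has an eigenvalue in the
fraction field, then its characteristic polynomial is `(X - u)(X - u⁻¹)` for a unit `u` of `R`. -/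
lemma charpoly_eq_of_mulVec_eq_smul {R K : Type*} [CommRing R] [IsDomain R]
    [IsIntegrallyClosed R] [Field K] [Algebra R K] [IsFractionRing R K] (γ : SL(2, R))
    {v : Fin 2 → K} (hv : v ≠ 0) {a : K}
    (h : ((γ : Matrix (Fin 2) (Fin 2) R).map (algebraMap R K)).mulVec v = a • v) :
    ∃ u : Rˣ, (γ : Matrix (Fin 2) (Fin 2) R).charpoly =
      (Polynomial.X - Polynomial.C (u : R)) *
        (Polynomial.X - Polynomial.C ((u⁻¹ : Rˣ) : R)) := by
  have hchar : (γ : Matrix (Fin 2) (Fin 2) R).charpoly =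
      Polynomial.X ^ 2 - Polynomial.C (γ : Matrix (Fin 2) (Fin 2) R).trace * Polynomial.X + 1 := by
    rw [Matrix.charpoly_fin_two, γ.det_coe, map_one]
  have hroot : Polynomial.aeval a (γ : Matrix (Fin 2) (Fin 2) R).charpoly = 0 := by
    rw [Polynomial.aeval_def, ← Polynomial.eval_map, ← Matrix.charpoly_map, Matrix.eval_charpoly,
      ← Matrix.exists_mulVec_eq_zero_iff]
    refine ⟨v, hv, ?_⟩
    rw [Matrix.sub_mulVec, h, Matrix.scalar_apply, ← Matrix.smul_one_eq_diagonal,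
      Matrix.smul_mulVec, Matrix.one_mulVec, sub_self]
  obtain ⟨x, rfl⟩ := IsIntegrallyClosed.isIntegral_iff.mp
    ⟨_, (γ : Matrix (Fin 2) (Fin 2) R).charpoly_monic, hroot⟩
  have hx : x * ((γ : Matrix (Fin 2) (Fin 2) R).trace - x) = 1 := by
    rw [Polynomial.aeval_algebraMap_apply, FaithfulSMul.algebraMap_eq_zero_iff, hchar] at hroot
    simp only [map_add, map_sub, map_mul, map_pow, map_one, Polynomial.aeval_X,
      Polynomial.aeval_C, Algebra.algebraMap_self, RingHom.id_apply] at hroot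
    linear_combination -hroot
  refine ⟨Units.mkOfMulEqOne _ _ hx, ?_⟩
  have hinv : (((Units.mkOfMulEqOne _ _ hx)⁻¹ : Rˣ) : R) =
      (γ : Matrix (Fin 2) (Fin 2) R).trace - x := rfl
  have hC := congrArg (Polynomial.C (R := R)) hx
  simp only [map_mul, map_sub, map_one] at hC
  rw [hchar, hinv, Units.val_mkOfMulEqOne, map_sub]
  linear_combination -hC

/-- If `γ ∈ SL₂(O_D)` fixes a point of `ℙ¹(F)`, then its characteristic
polynomial is `(X − u)(X − u⁻¹)` for a unit `u ∈ O_D^×`. -/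
theorem statement_7 (D : ℕ) (hD : Squarefree D) (hD0 : 0 < D)
    (γ : SL(2, 𝓞 (F D))) (η : P1 D) (hfix : γ • η = η) :
    ∃ u : (𝓞 (F D))ˣ,
      (γ : Matrix (Fin 2) (Fin 2) (𝓞 (F D))).charpoly =
        (Polynomial.X - Polynomial.C (u : 𝓞 (F D))) *
          (Polynomial.X - Polynomial.C ((u⁻¹ : (𝓞 (F D))ˣ) : 𝓞 (F D))) := by
  induction η using Projectivization.ind with
  | h v hv =>
    have hfix' : toSLF D γ • Projectivization.mk (F D) v hv = Projectivization.mk (F D) v hv := hfix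
    rw [smul_mk, Projectivization.mk_eq_mk_iff] at hfix'
    obtain ⟨a, ha⟩ := hfix'
    exact charpoly_eq_of_mulVec_eq_smul γ hv (a := (a : F D)) ha.symm

end Bianchi
end
end

section
/- Let 𝔞 ⊆ O_D be a nonzero ideal, let B = [[α, β], [γ, δ]] ∈ SL₂(F), let η := B⁻¹·[1 : 0] ∈ ℙ¹(F), and let 𝔲 be the fractional O_D-ideal generated by γ and δ. Then B·(Γ(𝔞)_η)·B⁻¹ ∩ N = { [[1, ω], [0, 1]] : ω ∈ 𝔞·𝔲⁻² }, where Γ(𝔞)_η is the stabilizer of η in Γ(𝔞) and N is the group of upper triangular unipotent matrices in SL₂(ℂ). -/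
open scoped MatrixGroups

set_option maxHeartbeats 1000000
set_option synthInstance.maxHeartbeats 400000

noncomputable section

namespace Bianchi

open NumberField MvPolynomial Finsupp
open scoped nonZeroDivisors

lemma mem_Gamma_iff (D : ℕ) (𝔞 : Ideal (𝓞 (F D))) (g : SL(2, 𝓞 (F D))) :
    g ∈ Gamma D 𝔞 ↔ ∀ i j, g.1 i j - (1 : Matrix (Fin 2) (Fin 2) (𝓞 (F D))) i j ∈ 𝔞 := by
  rw [Gamma, MonoidHom.mem_ker, Matrix.SpecialLinearGroup.ext_iff]
  refine forall₂_congr fun i j => ?_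
  rw [← Ideal.Quotient.eq]
  fin_cases i <;> fin_cases j <;> simp

lemma conj_unipotent {K : Type*} [Field K] (B x : SL(2, K)) (ω : K)
    (hx : (x : Matrix (Fin 2) (Fin 2) K) = !![1, ω; 0, 1]) :
    ((B⁻¹ * x * B : SL(2, K)) : Matrix (Fin 2) (Fin 2) K) =
      !![1 + ω * (B.1 1 0 * B.1 1 1), ω * B.1 1 1 ^ 2;
        -(ω * B.1 1 0 ^ 2), 1 - ω * (B.1 1 0 * B.1 1 1)] := by
  have hdet := B.2
  rw [Matrix.det_fin_two] at hdet
  rw [Matrix.SpecialLinearGroup.coe_mul, Matrix.SpecialLinearGroup.coe_mul, hx,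
    Matrix.SpecialLinearGroup.coe_inv, Matrix.adjugate_fin_two]
  ext i j
  fin_cases i <;> fin_cases j <;> simp [Matrix.mul_apply, Fin.sum_univ_two] <;>
    first | ring1 | linear_combination hdet

lemma unipotent_smul_infty {K : Type*} [Field K] (x : SL(2, K)) (ω : K)
    (hx : (x : Matrix (Fin 2) (Fin 2) K) = !![1, ω; 0, 1]) :
    x • infty K = infty K := by
  rw [infty, smul_mk]
  congr 1
  rw [hx]
  ext i
  fin_cases i <;> simp

/-- `ω ∈ I (c, d)⁻²` iff `ω` multiplies the generators of `(c, d)²` into `I`. -/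
lemma mem_mul_inv_sq_span_pair {R K : Type*} [CommRing R] [IsDedekindDomain R] [Field K]
    [Algebra R K] [IsFractionRing R K] (I : FractionalIdeal R⁰ K) (c d ω : K)
    (h : c ≠ 0 ∨ d ≠ 0) :
    ω ∈ I * (FractionalIdeal.spanSingleton R⁰ c + FractionalIdeal.spanSingleton R⁰ d)⁻¹ ^ 2 ↔
      ω * c ^ 2 ∈ I ∧ ω * (c * d) ∈ I ∧ ω * d ^ 2 ∈ I := by
  set u := FractionalIdeal.spanSingleton R⁰ c + FractionalIdeal.spanSingleton R⁰ d with hu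
  have hu0 : u ≠ 0 := by
    intro h0
    rw [hu, ← FractionalIdeal.sup_eq_add, ← FractionalIdeal.bot_eq_zero, sup_eq_bot_iff] at h0
    simp only [FractionalIdeal.bot_eq_zero, FractionalIdeal.spanSingleton_eq_zero_iff] at h0
    tauto
  have hsq : FractionalIdeal.spanSingleton R⁰ ω * u ^ 2 =
      FractionalIdeal.spanSingleton R⁰ (ω * c ^ 2) ⊔
        FractionalIdeal.spanSingleton R⁰ (ω * (c * d)) ⊔
        FractionalIdeal.spanSingleton R⁰ (ω * d ^ 2) := by
    have hidem : ∀ J : FractionalIdeal R⁰ K, J + J = J := fun J => by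
      rw [← FractionalIdeal.sup_eq_add, sup_idem]
    simp only [FractionalIdeal.sup_eq_add, ← FractionalIdeal.spanSingleton_mul_spanSingleton,
      ← FractionalIdeal.spanSingleton_pow]
    rw [hu, ← hidem (FractionalIdeal.spanSingleton R⁰ ω *
      (FractionalIdeal.spanSingleton R⁰ c * FractionalIdeal.spanSingleton R⁰ d))]
    ring
  rw [← FractionalIdeal.spanSingleton_le_iff_mem, inv_pow, ← div_eq_mul_inv,
    FractionalIdeal.le_div_iff_mul_le (pow_ne_zero 2 hu0), hsq, sup_le_iff, sup_le_iff]
  simp only [FractionalIdeal.spanSingleton_le_iff_mem, and_assoc]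

/-- Description of the unipotent part of the conjugated stabilizer:
`B Γ(𝔞)_η B⁻¹ ∩ N = {[[1, ω], [0, 1]] : ω ∈ 𝔞 𝔲⁻²}`, where `η = B⁻¹ ∞` and
`𝔲 = (γ, δ)` is generated by the bottom row of `B`. -/
theorem statement_9 (D : ℕ) (hD : Squarefree D) (hD0 : 0 < D)
    (𝔞 : Ideal (𝓞 (F D))) (h𝔞 : 𝔞 ≠ ⊥) (B : SL(2, F D))
    (η : P1 D) (hη : η = B⁻¹ • infty (F D))
    (𝔲 : FractionalIdeal (𝓞 (F D))⁰ (F D))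
    (h𝔲 : 𝔲 = FractionalIdeal.spanSingleton (𝓞 (F D))⁰
          ((B : Matrix (Fin 2) (Fin 2) (F D)) 1 0)
        + FractionalIdeal.spanSingleton (𝓞 (F D))⁰
          ((B : Matrix (Fin 2) (Fin 2) (F D)) 1 1)) :
    ∀ x : SL(2, F D),
      ((∃ γ : (Gamma D 𝔞), γ ∈ MulAction.stabilizer (Gamma D 𝔞) η ∧
            x = B * toSLF D (γ : SL(2, 𝓞 (F D))) * B⁻¹) ∧
        ∃ b : F D, (x : Matrix (Fin 2) (Fin 2) (F D)) = !![1, b; 0, 1]) ↔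
      (∃ ω : F D, ω ∈ (𝔞 : FractionalIdeal (𝓞 (F D))⁰ (F D)) * 𝔲⁻¹ ^ 2 ∧
        (x : Matrix (Fin 2) (Fin 2) (F D)) = !![1, ω; 0, 1]) := by
  subst hη h𝔲
  intro x
  have hdet := B.2
  rw [Matrix.det_fin_two] at hdet
  have h0 : B.1 1 0 ≠ 0 ∨ B.1 1 1 ≠ 0 := by
    by_contra! h
    simp [h.1, h.2] at hdet
  constructor
  · rintro ⟨⟨⟨g, hg⟩, -, hxg⟩, ω, hx⟩
    refine ⟨ω, ?_, hx⟩
    rw [mem_mul_inv_sq_span_pair _ _ _ _ h0]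
    have hg' := (mem_Gamma_iff D 𝔞 g).1 hg
    have hgF : toSLF D g = B⁻¹ * x * B := by
      rw [hxg]
      group
    have key := hgF ▸ conj_unipotent B x ω hx
    have hentry : ∀ i j, algebraMap (𝓞 (F D)) (F D) (g.1 i j) =
        (toSLF D g : Matrix (Fin 2) (Fin 2) (F D)) i j := fun _ _ => rfl
    simp only [FractionalIdeal.mem_coeIdeal]
    refine ⟨⟨-(g.1 1 0 - 0), 𝔞.neg_mem (by simpa using hg' 1 0), ?_⟩,
      ⟨g.1 0 0 - 1, by simpa using hg' 0 0, ?_⟩, ⟨g.1 0 1, by simpa using hg' 0 1, ?_⟩⟩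
    · rw [map_neg, map_sub, hentry, key]
      simp
    · rw [map_sub, hentry, key]
      simp
    · rw [hentry, key]
      simp
  · rintro ⟨ω, hω, hx⟩
    refine ⟨?_, ω, hx⟩
    rw [mem_mul_inv_sq_span_pair _ _ _ _ h0] at hω
    simp only [FractionalIdeal.mem_coeIdeal] at hω
    obtain ⟨⟨r, hr, hr'⟩, ⟨p, hp, hp'⟩, ⟨q, hq, hq'⟩⟩ := hω
    have hpqr : p ^ 2 = q * r := by
      apply FaithfulSMul.algebraMap_injective (𝓞 (F D)) (F D)
      rw [map_pow, map_mul, hp', hq', hr']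
      ring
    let g : SL(2, 𝓞 (F D)) := ⟨!![1 + p, q; -r, 1 - p], by
      rw [Matrix.det_fin_two_of]
      linear_combination -hpqr⟩
    have hgF : toSLF D g = B⁻¹ * x * B := by
      apply Subtype.ext
      rw [conj_unipotent B x ω hx, ← hr', ← hp', ← hq']
      ext1 i j
      change algebraMap (𝓞 (F D)) (F D) (g.1 i j) = _
      fin_cases i <;> fin_cases j <;> simp [g]
    have hg : g ∈ Gamma D 𝔞 := by
      rw [mem_Gamma_iff]
      intro i j
      fin_cases i <;> fin_cases j <;> simpa [g]
    refine ⟨⟨g, hg⟩, ?_, ?_⟩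
    · change toSLF D g • (B⁻¹ • infty (F D)) = B⁻¹ • infty (F D)
      rw [hgF, ← mul_smul, mul_inv_cancel_right, mul_smul, unipotent_smul_infty x ω hx]
    · rw [hgF]
      group

end Bianchi
end
end
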